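/- Let P and Q be probability measures on a common measurable space whose Kullback–Leibler divergence KL(P, Q) is finite, and let A be a measurable set. Then (1/2)·(P(Aᶜ) + Q(A)) ≥ (1/4)·exp(−KL(P, Q)). Consequently, max(P(Aᶜ), Q(A)) ≥ (1/4)·exp(−KL(P, Q)). -/

import Mathlib

open MeasureTheory Real

/-- The tangent line bound for `exp` at `-K / 2`, combined with the inequality of arithmetic and
geometric means for `exp (-l / 2)` with weight `s`. -/
lemma exp_tangent_le_weighted_mean (K l : ℝ) {s : ℝ} (hs : 0 < s) :
    exp (-K / 2) * (1 + K / 2) - exp (-K / 2) / 2 * l ≤ s / 2 + 1 / (2 * s) * exp (-l) := by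
  have htangent : exp (-K / 2) * (1 + K / 2 - l / 2) ≤ exp (-l / 2) := by
    have hmul : exp (-l / 2) = exp (-K / 2) * exp (K / 2 - l / 2) := by
      rw [← exp_add]; ring_nf
    rw [hmul]
    gcongr
    linarith [add_one_le_exp (K / 2 - l / 2)]
  have hsq : exp (-l) = exp (-l / 2) ^ 2 := by
    rw [← exp_nat_mul]; ring_nf
  have hmean : s / 2 + 1 / (2 * s) * exp (-l) - exp (-l / 2)
      = (s - exp (-l / 2)) ^ 2 / (2 * s) := by
    rw [hsq]; field_simp; ring
  have hnonneg : 0 ≤ (s - exp (-l / 2)) ^ 2 / (2 * s) := by positivity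
  linarith

lemma integrable_exp_neg_llr {α : Type*} [MeasurableSpace α] {P Q : Measure α}
    [SigmaFinite P] [IsFiniteMeasure Q] (hac : P ≪ Q) :
    Integrable (fun x ↦ exp (-llr P Q x)) P :=
  Measure.integrable_toReal_rnDeriv.congr (exp_neg_llr hac).symm

lemma setIntegral_exp_neg_llr_le {α : Type*} [MeasurableSpace α] {P Q : Measure α}
    [SigmaFinite P] [IsFiniteMeasure Q] (hac : P ≪ Q) (B : Set α) :
    ∫ x in B, exp (-llr P Q x) ∂P ≤ Q.real B := by
  rw [integral_congr_ae (ae_restrict_of_ae (exp_neg_llr hac))]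
  exact Measure.setIntegral_toReal_rnDeriv_le (measure_ne_top Q B)

/-- Integrated form of `exp_tangent_le_weighted_mean` over a set. -/
lemma setIntegral_llr_tangent_le {α : Type*} [MeasurableSpace α] {P Q : Measure α}
    [IsFiniteMeasure P] [IsFiniteMeasure Q] (hac : P ≪ Q) (hint : Integrable (llr P Q) P)
    (K : ℝ) {s : ℝ} (hs : 0 < s) (B : Set α) :
    ∫ x in B, (exp (-K / 2) * (1 + K / 2) - exp (-K / 2) / 2 * llr P Q x) ∂P
      ≤ s / 2 * P.real B + 1 / (2 * s) * Q.real B := by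
  have hexp := ((integrable_exp_neg_llr hac).const_mul (1 / (2 * s))).integrableOn (s := B)
  calc
    _ ≤ ∫ x in B, (s / 2 + 1 / (2 * s) * exp (-llr P Q x)) ∂P :=
      integral_mono ((integrable_const _).sub (hint.integrableOn.const_mul _))
        ((integrable_const _).add hexp) fun x ↦ exp_tangent_le_weighted_mean K (llr P Q x) hs
    _ = s / 2 * P.real B + 1 / (2 * s) * ∫ x in B, exp (-llr P Q x) ∂P := by
      rw [integral_add (integrable_const _) hexp, integral_const_mul, setIntegral_const,
        smul_eq_mul, mul_comm (P.real B)]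
    _ ≤ _ := by
      gcongr
      exact setIntegral_exp_neg_llr_le hac B

/-- Bretagnolle–Huber inequality: if the Kullback–Leibler divergence
`KL(P,Q) = ∫ log(dP/dQ) dP` is finite (i.e. `P ≪ Q` and the log-likelihood ratio is
`P`-integrable), then for any measurable event `A`,
`(1/2)(P(Aᶜ) + Q(A)) ≥ (1/4)·exp(−KL(P,Q))`, and consequently
`max(P(Aᶜ), Q(A)) ≥ (1/4)·exp(−KL(P,Q))`. -/
theorem bretagnolle_huber {α : Type*} [MeasurableSpace α]
    (P Q : Measure α) [IsProbabilityMeasure P] [IsProbabilityMeasure Q]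
    (hac : P ≪ Q) (hint : Integrable (llr P Q) P)
    (A : Set α) (hA : MeasurableSet A) :
    (1 / 2) * ((P Aᶜ).toReal + (Q A).toReal)
        ≥ (1 / 4) * Real.exp (-(∫ x, llr P Q x ∂P)) ∧
    max (P Aᶜ).toReal (Q A).toReal ≥ (1 / 4) * Real.exp (-(∫ x, llr P Q x ∂P)) := by
  set K := ∫ x, llr P Q x ∂P with hK
  set c := exp (-K / 2) with hc
  have hc_pos : 0 < c := exp_pos _
  have hsq : exp (-K) = c ^ 2 := by
    rw [hc, ← exp_nat_mul]; ring_nf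
  have htangent : Integrable (fun x ↦ c * (1 + K / 2) - c / 2 * llr P Q x) P :=
    (integrable_const _).sub (hint.const_mul _)
  have htotal : ∫ x, (c * (1 + K / 2) - c / 2 * llr P Q x) ∂P = c := by
    rw [integral_sub (integrable_const _) (hint.const_mul _), integral_const_mul (c / 2), ← hK]
    simp only [integral_const, probReal_univ, one_smul]
    ring
  have hsplit := integral_add_compl hA htangent
  have hle := setIntegral_llr_tangent_le hac hint K (half_pos hc_pos) A
  have hle_compl := setIntegral_llr_tangent_le hac hint K (div_pos two_pos hc_pos) Aᶜ
  have hPA : P.real A = 1 - P.real Aᶜ := by rw [probReal_compl_eq_one_sub hA]; ring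
  have hQA : Q.real Aᶜ = 1 - Q.real A := probReal_compl_eq_one_sub hA
  rw [← hc, hPA] at hle
  rw [← hc, hQA] at hle_compl
  rw [htotal] at hsplit
  change (1 / 2) * (P.real Aᶜ + Q.real A) ≥ _ ∧ max (P.real Aᶜ) (Q.real A) ≥ _
  have hP : 0 ≤ P.real Aᶜ := measureReal_nonneg
  have hQ : 0 ≤ Q.real A := measureReal_nonneg
  have hsum : c ≤ (c / 2 / 2 * (1 - P.real Aᶜ) + 1 / (2 * (c / 2)) * Q.real A)
      + (2 / c / 2 * P.real Aᶜ + 1 / (2 * (2 / c)) * (1 - Q.real A)) := by linarith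
  have hbound : c ^ 2 ≤ 2 * (P.real Aᶜ + Q.real A) := by
    field_simp at hsum
    nlinarith [mul_nonneg (sq_nonneg c) hP, mul_nonneg (sq_nonneg c) hQ]
  have hhalf : (1 / 2) * (P.real Aᶜ + Q.real A) ≥ (1 / 4) * exp (-K) := by
    rw [hsq]; linarith
  refine ⟨hhalf, ?_⟩
  linarith [le_max_left (P.real Aᶜ) (Q.real A), le_max_right (P.real Aᶜ) (Q.real A)]
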